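/- Let V ⊆ D be a set of data values, let (E_w)_{w ∈ D} be a family of subsets of D, let d ∈ Var be a data variable and Y ∈ PV a predicate variable, and let P := P_{V,E,d,Y} be the combine predicate. Then for every v ∈ V, every predicate environment η, every predicate formula φ in which d is unbound, and every data environment δ: if ⟦φ[Y := P]⟧η(δ[v/d]) holds, then ⟦φ⟧η(δ[v/d]) holds. -/

import Mathlib

namespace PBESPaper

/-- Fixpoint signs μ and ν. -/
inductive FixKind : Type where
  | mu : FixKind
  | nu : FixKind
deriving DecidableEq

/-- Predicate formulas: atomic predicates, applications of predicate variables to a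
data term, conjunction, disjunction, and existential/universal quantification over
a data variable.  Note: no negation. -/
inductive PForm (D Var PV : Type*) where
  | atom (b : (Var → D) → Prop)
  | app (Y : PV) (e : (Var → D) → D)
  | conj (φ ψ : PForm D Var PV)
  | disj (φ ψ : PForm D Var PV)
  | ex (d : Var) (φ : PForm D Var PV)
  | all (d : Var) (φ : PForm D Var PV)

variable {D Var PV : Type*}

/-- Predicate environments. -/
abbrev PEnv (D PV : Type*) := PV → D → Prop

/-- Data environments. -/
abbrev DEnv (D Var : Type*) := Var → D

/-- Semantic predicate functions, used for (semantic) substitution. -/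
abbrev SemPred (D Var PV : Type*) := PEnv D PV → DEnv D Var → D → Prop

/-- The semantics ⟦φ⟧ηδ of a predicate formula. -/
def PForm.sem [DecidableEq Var] : PForm D Var PV → PEnv D PV → DEnv D Var → Prop
  | .atom b, _, δ => b δ
  | .app Y e, η, δ => η Y (e δ)
  | .conj φ ψ, η, δ => PForm.sem φ η δ ∧ PForm.sem ψ η δ
  | .disj φ ψ, η, δ => PForm.sem φ η δ ∨ PForm.sem ψ η δ
  | .ex d φ, η, δ => ∃ v : D, PForm.sem φ η (Function.update δ d v)
  | .all d φ, η, δ => ∀ v : D, PForm.sem φ η (Function.update δ d v)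

/-- The substituted semantics ⟦φ[...]⟧ηδ, where every predicate variable `Y` is
(simultaneously) interpreted by the semantic predicate function `S Y`. -/
def PForm.semSub [DecidableEq Var] (S : PV → SemPred D Var PV) :
    PForm D Var PV → PEnv D PV → DEnv D Var → Prop
  | .atom b, _, δ => b δ
  | .app Y e, η, δ => S Y η δ (e δ)
  | .conj φ ψ, η, δ => PForm.semSub S φ η δ ∧ PForm.semSub S ψ η δ
  | .disj φ ψ, η, δ => PForm.semSub S φ η δ ∨ PForm.semSub S ψ η δ
  | .ex d φ, η, δ => ∃ v : D, PForm.semSub S φ η (Function.update δ d v)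
  | .all d φ, η, δ => ∀ v : D, PForm.semSub S φ η (Function.update δ d v)

/-- The identity substitution: `Y` is interpreted as `η Y`, i.e. left unchanged. -/
def idSub : PV → SemPred D Var PV := fun Y η _ a => η Y a

/-- Substitution of a single predicate variable `Y` by `P`; all other predicate
variables are left unchanged, so `PForm.semSub (subst1 Y P) φ` is ⟦φ[Y := P]⟧. -/
def subst1 [DecidableEq PV] (Y : PV) (P : SemPred D Var PV) : PV → SemPred D Var PV :=
  fun Z => if Z = Y then P else idSub Z

/-- `d` is unbound in `φ`: no quantifier over `d` occurs in `φ`. -/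
def PForm.unbound (d : Var) : PForm D Var PV → Prop
  | .atom _ => True
  | .app _ _ => True
  | .conj φ ψ => PForm.unbound d φ ∧ PForm.unbound d ψ
  | .disj φ ψ => PForm.unbound d φ ∧ PForm.unbound d ψ
  | .ex d' φ => d' ≠ d ∧ PForm.unbound d φ
  | .all d' φ => d' ≠ d ∧ PForm.unbound d φ

/-- The combine predicate P_{V,E,d,Y}, modelling the substitution of
λe.⋀_{w∈V}(d ≈ w ⟹ e ∈ E_w ∧ Y(e)) for Y. -/
def combinePred (V : Set D) (E : D → Set D) (d : Var) (Y : PV) : SemPred D Var PV :=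
  fun η δ a => ∀ w ∈ V, δ d = w → (a ∈ E w ∧ η Y a)

/-- A PBES: a finite sequence of equations (σᵢ, Xᵢ, φᵢ) with pairwise distinct
bound variables, and a common parameter variable that is unbound in every
right-hand side. -/
structure PBES (D Var PV : Type*) where
  eqns : List (FixKind × PV × PForm D Var PV)
  param : Var
  nodup : (eqns.map fun e => e.2.1).Nodup
  unbound_param : ∀ e ∈ eqns, PForm.unbound param e.2.2

/-- The set of bound predicate variables of a PBES. -/
def PBES.bnd (E : PBES D Var PV) : Set PV := {X | ∃ e ∈ E.eqns, e.2.1 = X}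

/-- The signature of a PBES: pairs (X, v) with X bound in E and v a data value. -/
def PBES.sig (E : PBES D Var PV) : Set (PV × D) := {p | p.1 ∈ E.bnd}

/-- `rk` is a rank function for `E`: the rank of a bound variable is even iff its
sign is ν, and ranks are monotone in the order of the equations. -/
def IsRankFn (E : PBES D Var PV) (rk : PV → ℕ) : Prop :=
  (∀ e ∈ E.eqns, (Even (rk e.2.1) ↔ e.1 = FixKind.nu)) ∧
  (∀ i j : Fin E.eqns.length, (i : ℕ) ≤ (j : ℕ) →
    rk (E.eqns.get i).2.1 ≤ rk (E.eqns.get j).2.1)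

/-- The predicate variable `X` occurs infinitely often on the path `π`. -/
def InfOften (π : ℕ → PV × D) (X : PV) : Prop := ∀ n : ℕ, ∃ m, n ≤ m ∧ (π m).1 = X

/-- `(V, Ed)` is a proof graph for the PBES obtained from `E` by replacing the
right-hand side `φ_X` of each equation by its substituted semantics under `Sf X`
(taking `Sf = fun _ => idSub` yields proof graphs for `E` itself):
(1) every vertex is labelled by a bound variable, edges connect vertices,
(2) for every vertex (X,v) and every δ, the (substituted) right-hand side of X
holds in the environment induced by the successors of (X,v), with the parameter
set to v, and (3) on every infinite path the minimum rank among the variables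
occurring infinitely often is even. -/
def IsProofGraph [DecidableEq Var] (E : PBES D Var PV) (Sf : PV → PV → SemPred D Var PV)
    (V : Set (PV × D)) (Ed : Set ((PV × D) × (PV × D))) : Prop :=
  (∀ p ∈ V, p.1 ∈ E.bnd) ∧
  (∀ e ∈ Ed, e.1 ∈ V ∧ e.2 ∈ V) ∧
  (∀ X : PV, ∀ v : D, (X, v) ∈ V → ∀ σ : FixKind, ∀ φ : PForm D Var PV,
      (σ, X, φ) ∈ E.eqns → ∀ δ : DEnv D Var,
      PForm.semSub (Sf X) φ (fun Y w => ((X, v), (Y, w)) ∈ Ed) (Function.update δ E.param v)) ∧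
  (∀ rk : PV → ℕ, IsRankFn E rk →
    ∀ π : ℕ → PV × D, (∀ n : ℕ, (π n, π (n + 1)) ∈ Ed) →
      Even (sInf (rk '' {X : PV | InfOften π X})))

/-- The identity substitution assignment: each equation keeps its right-hand side. -/
def idAssign : PV → PV → SemPred D Var PV := fun _ => idSub

/-- The solution of the PBES determined by `E` and the substitution assignment `Sf`:
⟦E⟧(X)(v) holds iff X is bound and (X,v) belongs to some proof graph. -/
def sol [DecidableEq Var] (E : PBES D Var PV) (Sf : PV → PV → SemPred D Var PV)
    (X : PV) (v : D) : Prop :=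
  X ∈ E.bnd ∧ ∃ V Ed, IsProofGraph E Sf V Ed ∧ (X, v) ∈ V

/-- `E = E_L E_{Z⁺} E_{Z⁻}` is partitioned: the bound variables are partitioned
into 𝒳_L (the prefix E_L), 𝒵⁺ (equations (ν, Z, true)) and 𝒵⁻ (equations
(μ, Z, false)). -/
structure Partitioned (E : PBES D Var PV) (XL Zp Zm : Set PV) : Prop where
  disjLp : Disjoint XL Zp
  disjLm : Disjoint XL Zm
  disjpm : Disjoint Zp Zm
  cover : E.bnd = XL ∪ Zp ∪ Zm
  shape : ∃ lL lp lm : List (FixKind × PV × PForm D Var PV),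
      E.eqns = lL ++ lp ++ lm ∧
      (∀ e ∈ lL, e.2.1 ∈ XL) ∧ (∀ e ∈ lp, e.2.1 ∈ Zp) ∧ (∀ e ∈ lm, e.2.1 ∈ Zm)
  zp_rhs : ∀ e ∈ E.eqns, e.2.1 ∈ Zp → e.1 = FixKind.nu ∧ e.2.2 = PForm.atom (fun _ => True)
  zm_rhs : ∀ e ∈ E.eqns, e.2.1 ∈ Zm → e.1 = FixKind.mu ∧ e.2.2 = PForm.atom (fun _ => False)

open Classical in
/-- The substitution assignment of core(E): every Z ∈ 𝒵⁺ is replaced by the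
semantic predicate constantly True, every Z ∈ 𝒵⁻ by the one constantly False. -/
noncomputable def coreSub (Zp Zm : Set PV) : PV → PV → SemPred D Var PV :=
  fun _X Z =>
    if Z ∈ Zp then fun _ _ _ => True
    else if Z ∈ Zm then fun _ _ _ => False
    else idSub Z

open Classical in
/-- The substitution assignment of true(E): every Z ∈ 𝒵⁻ is replaced by the
semantic predicate constantly False. -/
noncomputable def trueSub (Zm : Set PV) : PV → PV → SemPred D Var PV :=
  fun _X Z => if Z ∈ Zm then fun _ _ _ => False else idSub Z

open Classical in
/-- The substitution assignment of combine(true(E), G) for a graph G = (VG, EdG):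
in the right-hand side of the equation for X, every Z ∈ 𝒵⁻ is replaced by False
(this is true(E)), and every bound variable Y ∉ 𝒵⁺ ∪ 𝒵⁻ is replaced by the
predicate P_Y η δ a := ∀ v, (X,v) ∈ VG → δ(d) = v → (a ∈ E_{X(v),Y} ∧ η Y a),
where E_{X(v),Y} = { w | ((X,v),(Y,w)) ∈ EdG }. -/
noncomputable def combineTrueSub (E : PBES D Var PV) (Zp Zm : Set PV)
    (VG : Set (PV × D)) (EdG : Set ((PV × D) × (PV × D))) :
    PV → PV → SemPred D Var PV :=
  fun X Y =>
    if Y ∈ Zm then fun _ _ _ => False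
    else if Y ∈ Zp then idSub Y
    else if Y ∈ E.bnd then
      fun η δ a => ∀ v : D, (X, v) ∈ VG → δ E.param = v →
        (((X, v), (Y, a)) ∈ EdG ∧ η Y a)
    else idSub Y


/-- Lemma 6, reverse direction: for v ∈ V and any η,
if ⟦φ[Y := P_{V,E,d,Y}]⟧η(δ[v/d]) holds then ⟦φ⟧η(δ[v/d]) holds, provided d is
unbound in φ. -/
theorem combine_subst_reflects_solution
    {D Var PV : Type*} [DecidableEq Var] [DecidableEq PV]
    (V : Set D) (E : D → Set D) (d : Var) (Y : PV) :
    ∀ v ∈ V, ∀ η : PEnv D PV,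
    ∀ φ : PForm D Var PV, PForm.unbound d φ →
    ∀ δ : DEnv D Var,
      PForm.semSub (subst1 Y (combinePred V E d Y)) φ η (Function.update δ d v) →
      PForm.sem φ η (Function.update δ d v) := by
  intro v hv η φ hφ δ
  have key : ∀ φ : PForm D Var PV, PForm.unbound d φ → ∀ δ : DEnv D Var, δ d = v →
      PForm.semSub (subst1 Y (combinePred V E d Y)) φ η δ → PForm.sem φ η δ := by
    intro φ
    induction φ with
    | atom b => intro _ δ _ h; exact h
    | app Z e =>
      intro _ δ hδ h
      simp only [PForm.semSub, subst1] at h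
      by_cases hZ : Z = Y
      · subst hZ
        rw [if_pos rfl] at h
        exact (h v hv hδ).2
      · rw [if_neg hZ] at h
        exact h
    | conj a b iha ihb =>
      intro hu δ hδ h
      exact ⟨iha hu.1 δ hδ h.1, ihb hu.2 δ hδ h.2⟩
    | disj a b iha ihb =>
      intro hu δ hδ h
      exact Or.imp (iha hu.1 δ hδ) (ihb hu.2 δ hδ) h
    | ex x a ih =>
      intro hu δ hδ h
      obtain ⟨w, hw⟩ := h
      exact ⟨w, ih hu.2 _ (by rw [Function.update_of_ne hu.1.symm]; exact hδ) hw⟩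
    | all x a ih =>
      intro hu δ hδ h w
      exact ih hu.2 _ (by rw [Function.update_of_ne hu.1.symm]; exact hδ) (h w)
  exact key φ hφ _ (Function.update_self ..)

end PBESPaper
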